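/- Let 𝒜 be an irreducible Coxeter arrangement with Coxeter group W, let H ∈ 𝒜, let s ∈ W be the orthogonal reflection through H, and let θ ∈ D(𝒜, −∞) be W-invariant. If θ(α_H) ∈ α_H^{2m} S_{(α_H)} for some m ∈ ℤ, then θ(α_H) ∈ α_H^{2m+1} S_{(α_H)}. -/

import Mathlib

/-!
Common setup for formalizing "Primitive derivations, Shi arrangements,
and Bandlow-Musiker-Wagon identities" style results on equivariant
multiplicities of Coxeter arrangements (Abe–Terao).

We work with the polynomial ring `S = ℝ[x_1, …, x_n]` (the symmetric algebra
of `V*` in orthonormal coordinates), its fraction field `F`, and the module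
`Der_F` of ℝ-linear derivations of `F`.  All structures of the paper
(the Coxeter arrangement `𝒜`, the Coxeter group `W` with its actions,
basic invariants, the primitive derivation, the Levi-Civita connection `∇`,
the module `D(𝒜, −∞)` and the modules `D(𝒜, m)`) are packaged, with their
characterizing properties, in the structures `CoxSetup` / `CoxSetup2` below.
-/

open MvPolynomial

noncomputable section

set_option synthInstance.maxHeartbeats 1000000
set_option maxHeartbeats 1000000

/-- `S`: the symmetric algebra of `V*`, i.e. the polynomial ring in the
orthonormal coordinates `x_1, …, x_n` of the `n`-dimensional Euclidean space `V`. -/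
abbrev SS (n : ℕ) : Type := MvPolynomial (Fin n) ℝ

/-- `F`: the quotient field of `S`. -/
abbrev FF (n : ℕ) : Type := FractionRing (SS n)

/-- `Der_F`: the `F`-module of ℝ-linear derivations of `F`. -/
abbrev DerF (n : ℕ) : Type := Derivation ℝ (FF n) (FF n)

variable {n : ℕ}

/-- The canonical embedding `S → F`. -/
def toF (f : SS n) : FF n := algebraMap (SS n) (FF n) f

/-- The coordinate `x_i`, viewed in `F`. -/
def XF (i : Fin n) : FF n := toF (X i)

/-- `f ∈ α^m ⬝ S_{(α)}` inside `F`, where `S_{(α)}` is the localization of `S`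
at the prime ideal `(α)` and `m ∈ ℤ`. -/
def MemLoc (α : SS n) (m : ℤ) (f : FF n) : Prop :=
  ∃ s t : SS n, t ∉ Ideal.span ({α} : Set (SS n)) ∧
    f * toF t = (toF α) ^ m * toF s

/-- `f ∈ F` is homogeneous of degree `d ∈ ℤ` (a quotient of homogeneous
polynomials whose degrees differ by `d`). -/
def HomogF (f : FF n) (d : ℤ) : Prop :=
  ∃ (s t : SS n) (a b : ℕ), t ≠ 0 ∧ s.IsHomogeneous a ∧ t.IsHomogeneous b ∧
    (a : ℤ) - (b : ℤ) = d ∧ f * toF t = toF s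

/-- A derivation `θ ≠ 0` is homogeneous of degree `d`: `θ(α)` is homogeneous of
degree `d` whenever `θ(α) ≠ 0`, for `α ∈ V*` (degree-one forms). -/
def DerHomog (θ : DerF n) (d : ℤ) : Prop :=
  θ ≠ 0 ∧ ∀ p : SS n, p.IsHomogeneous 1 →
    θ (toF p) = 0 ∨ HomogF (θ (toF p)) d

/-- The inner product `I*` on linear forms, in the orthonormal coordinates. -/
def ip1 (p q : SS n) : ℝ :=
  ∑ i, p.coeff (Finsupp.single i 1) * q.coeff (Finsupp.single i 1)

/-- `θ` restricts to a derivation of `S` (an element of `Der_S`). -/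
def IsPolyDer (θ : DerF n) : Prop := ∀ i : Fin n, ∃ s : SS n, θ (XF i) = toF s

/-- Conjugation of a derivation by a field automorphism: `θ ↦ e ∘ θ ∘ e⁻¹`.
This is the natural action of automorphisms on `Der_F`. -/
def conjDer (e : FF n ≃ₐ[ℝ] FF n) (θ : DerF n) : DerF n where
  toLinearMap := e.toLinearMap ∘ₗ θ.toLinearMap ∘ₗ e.symm.toLinearMap
  map_one_eq_zero' := by
    simp [Derivation.map_one_eq_zero]
  leibniz' := by
    intro a b
    have h : e.symm (a * b) = e.symm a * e.symm b := map_mul _ _ _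
    simp only [LinearMap.coe_comp, Function.comp_apply, AlgEquiv.toLinearMap_apply,
      Derivation.coeFn_coe, h, Derivation.leibniz, smul_eq_mul, map_add, map_mul,
      AlgEquiv.apply_symm_apply]

/-- The index of the top-degree basic invariant. -/
def lastIdx (n : ℕ) (hn : 0 < n) : Fin n := ⟨n - 1, Nat.sub_lt hn Nat.one_pos⟩

/-- Integer iterates of a map `f` whose inverse (on the relevant set) is `g`. -/
def zpowIter {X : Type*} (f g : X → X) : ℤ → X → X
  | Int.ofNat k => f^[k]
  | Int.negSucc k => g^[k + 1]

/-- `Θ` is a basis of the set `M ⊆ Der_F` over the subring of `S` given by the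
set of coefficients `Coef` (e.g. `Coef = Set.univ` for an `S`-basis, `Coef = R`
for an `R`-basis, `Coef = T` for a `T`-basis). -/
def isBasisOver {ι : Type*} (Coef : Set (SS n)) (Θ : ι → DerF n)
    (M : Set (DerF n)) : Prop :=
  (∀ i, Θ i ∈ M) ∧
  (∀ c : ι →₀ SS n, (∀ i, c i ∈ Coef) →
    (c.sum fun i f => toF f • Θ i) = 0 → c = 0) ∧
  (∀ δ ∈ M, ∃ c : ι →₀ SS n, (∀ i, c i ∈ Coef) ∧
    δ = c.sum fun i f => toF f • Θ i)

/-- `θ_1, …, θ_n` is an `S`-basis of the set `M ⊆ Der_F`. -/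
def IsSBasis {ι : Type*} [Fintype ι] (Θ : ι → DerF n) (M : Set (DerF n)) : Prop :=
  (∀ i, Θ i ∈ M) ∧
  (∀ c : ι → SS n, (∑ i, toF (c i) • Θ i) = 0 → ∀ i, c i = 0) ∧
  (∀ δ ∈ M, ∃ c : ι → SS n, δ = ∑ i, toF (c i) • Θ i)

/-- An `n`-dimensional irreducible Coxeter arrangement `𝒜` (hyperplanes indexed
by `hyp`, with defining linear forms `α`), together with its Coxeter group `W`
(acting orthogonally on `V`, hence on `S`, on `F` and on hyperplanes), a set of
basic invariants `P_1, …, P_n` of degrees `d_1 ≤ … ≤ d_n = h`, the partial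
derivatives `∂/∂x_i` and `∂/∂P_i` (so `D = ∂/∂P_n` is a primitive derivation),
the Euler derivation `E`, the Levi-Civita connection `∇` of the flat metric `I`,
the module `D(𝒜, −∞)` of Abe–Terao, and the inverse of the `T`-linear
automorphism `∇_D` of `D(𝒜, −∞)^W`. -/
structure CoxSetup (n : ℕ) (hn : 0 < n) (hyp W : Type)
    [Fintype hyp] [Group W] [Fintype W] : Type where
  hypNe : Nonempty hyp
  /-- the defining linear forms of the hyperplanes -/
  α : hyp → SS n
  α_ne : ∀ H, α H ≠ 0
  α_hom : ∀ H, (α H).IsHomogeneous 1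
  α_red : ∀ H H' : hyp, (∃ c : ℝ, c ≠ 0 ∧ α H = c • α H') → H = H'
  /-- the action of `W` on `S` by graded `ℝ`-algebra automorphisms -/
  actS : W →* (SS n ≃ₐ[ℝ] SS n)
  actS_lin : ∀ (w : W) (p : SS n), p.IsHomogeneous 1 → (actS w p).IsHomogeneous 1
  /-- `W` acts orthogonally -/
  actS_orth : ∀ (w : W) (p q : SS n), p.IsHomogeneous 1 → q.IsHomogeneous 1 →
      ip1 (actS w p) (actS w q) = ip1 p q
  actS_faithful : ∀ w : W, (∀ f, actS w f = f) → w = 1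
  /-- the action of `W` on the set of hyperplanes -/
  σ : W →* Equiv.Perm hyp
  σ_compat : ∀ (w : W) (H : hyp), ∃ c : ℝ, c ≠ 0 ∧ actS w (α H) = c • α (σ w H)
  /-- the orthogonal reflection through each hyperplane of `𝒜` -/
  reflW : hyp → W
  reflW_α : ∀ H, actS (reflW H) (α H) = - α H
  reflW_fix : ∀ (H) (p : SS n), p.IsHomogeneous 1 → ip1 p (α H) = 0 →
      actS (reflW H) p = p
  /-- `W` is generated by the reflections -/
  W_gen : Subgroup.closure (Set.range reflW) = (⊤ : Subgroup W)
  /-- `𝒜` is the full reflection arrangement of `W` -/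
  hyp_all : ∀ (w : W) (p : SS n), p.IsHomogeneous 1 → p ≠ 0 → actS w p = -p →
      (∀ q : SS n, q.IsHomogeneous 1 → ip1 p q = 0 → actS w q = q) →
      ∃ (H : hyp) (c : ℝ), c ≠ 0 ∧ p = c • α H
  /-- irreducibility: `W` acts irreducibly on `V*` -/
  irred : ∀ U : Submodule ℝ (SS n), U ≤ Submodule.span ℝ (Set.range X) →
      (∀ (w : W), ∀ p ∈ U, actS w p ∈ U) →
      U = ⊥ ∨ U = Submodule.span ℝ (Set.range X)
  /-- the induced action of `W` on the quotient field `F` -/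
  actF : W →* (FF n ≃ₐ[ℝ] FF n)
  actF_compat : ∀ (w : W) (f : SS n), actF w (toF f) = toF (actS w f)
  /-- basic invariants `P_1, …, P_n` of `W`, of degrees `d_1 ≤ … ≤ d_n = h` -/
  P : Fin n → SS n
  d : Fin n → ℕ
  d_mono : Monotone d
  d_pos : ∀ i, 0 < d i
  P_hom : ∀ i, (P i).IsHomogeneous (d i)
  P_inv : ∀ (w : W) (i : Fin n), actS w (P i) = P i
  P_indep : AlgebraicIndependent ℝ P
  P_gen : ∀ f : SS n, (∀ w : W, actS w f = f) → f ∈ Algebra.adjoin ℝ (Set.range P)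
  /-- the partial derivatives `∂/∂x_i`, as derivations of `F` -/
  dX : Fin n → DerF n
  dX_eq : ∀ i j, dX i (XF j) = if i = j then 1 else 0
  /-- the partial derivatives `∂/∂P_i`, as derivations of `F`;
  `∂/∂P_n` is the primitive derivation `D` -/
  dP : Fin n → DerF n
  dP_eq : ∀ i j, dP i (toF (P j)) = if i = j then 1 else 0
  /-- the Euler derivation -/
  Eul : DerF n
  Eul_eq : ∀ i, Eul (XF i) = XF i
  /-- the Levi-Civita connection of the flat metric `I`, characterized in the
  orthonormal coordinates by `(∇_θ δ)(x_i) = θ(δ(x_i))` -/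
  nabla : DerF n → DerF n → DerF n
  nabla_eq : ∀ (θ δ : DerF n) (i : Fin n), nabla θ δ (XF i) = θ (δ (XF i))
  /-- the module `D(𝒜, −∞) = I*(Ω¹(𝒜, ∞))` of Abe–Terao -/
  Dinf : Set (DerF n)
  Dinf_zero : (0 : DerF n) ∈ Dinf
  Dinf_add : ∀ θ δ, θ ∈ Dinf → δ ∈ Dinf → θ + δ ∈ Dinf
  Dinf_smul : ∀ (f : SS n) (θ), θ ∈ Dinf → toF f • θ ∈ Dinf
  Dinf_poly : ∀ θ : DerF n, IsPolyDer θ → θ ∈ Dinf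
  Dinf_stab : ∀ (w : W) (θ), θ ∈ Dinf → conjDer (actF w) θ ∈ Dinf
  /-- the inverse of the `T`-linear automorphism
  `∇_D : D(𝒜, −∞)^W → D(𝒜, −∞)^W` ([AT08, AT09]) -/
  nablaDinv : DerF n → DerF n
  nablaDinv_spec : ∀ θ : DerF n, θ ∈ Dinf → (∀ w : W, conjDer (actF w) θ = θ) →
      nablaDinv θ ∈ Dinf ∧ (∀ w : W, conjDer (actF w) (nablaDinv θ) = nablaDinv θ) ∧
      nabla (dP (lastIdx n hn)) (nablaDinv θ) = θ ∧
      nablaDinv (nabla (dP (lastIdx n hn)) θ) = θ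

variable {hn : 0 < n} {hyp W : Type} [Fintype hyp] [Group W] [Fintype W]

/-- The natural action of `w ∈ W` on `Der_F`. -/
def actDer (C : CoxSetup n hn hyp W) (w : W) (θ : DerF n) : DerF n :=
  conjDer (C.actF w) θ

/-- `θ` is `W`-invariant. -/
def invDer (C : CoxSetup n hn hyp W) (θ : DerF n) : Prop :=
  ∀ w : W, actDer C w θ = θ

/-- The module `D(𝒜, m)` attached to a multiplicity `m : 𝒜 → ℤ`. -/
def Dmod (C : CoxSetup n hn hyp W) (m : hyp → ℤ) : Set (DerF n) :=
  {θ | θ ∈ C.Dinf ∧ ∀ H : hyp, MemLoc (C.α H) (m H) (θ (toF (C.α H)))}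

/-- The `W`-invariant part `D(𝒜, m)^W`. -/
def DmodW (C : CoxSetup n hn hyp W) (m : hyp → ℤ) : Set (DerF n) :=
  {θ | θ ∈ Dmod C m ∧ invDer C θ}

/-- The invariant ring `R = S^W`. -/
def Rinv (C : CoxSetup n hn hyp W) : Set (SS n) :=
  {f | ∀ w : W, C.actS w f = f}

/-- The primitive derivation `D = ∂/∂P_n`. -/
def Dprim (C : CoxSetup n hn hyp W) : DerF n := C.dP (lastIdx n hn)

/-- `T = {f ∈ R | D f = 0} = ℝ[P_1, …, P_{n-1}]`. -/
def Tker (C : CoxSetup n hn hyp W) : Set (SS n) :=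
  {f | f ∈ Rinv C ∧ Dprim C (toF f) = 0}

/-- `ζ` is `m`-universal : `ζ` is a homogeneous `W`-invariant element of
`D(𝒜, −∞)` and `Ψ_ζ : Der_S → D(𝒜, 2m)`, `θ ↦ ∇_θ ζ`, is bijective. -/
def isUniversal (C : CoxSetup n hn hyp W) (m : hyp → ℤ) (ζ : DerF n) : Prop :=
  ζ ∈ C.Dinf ∧ invDer C ζ ∧ (∃ dg : ℤ, DerHomog ζ dg) ∧
  Set.BijOn (fun θ => C.nabla θ ζ) {θ | IsPolyDer θ}
    (Dmod C fun H => 2 * m H)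

/-- The equivariant odd multiplicity `m*` associated to an arbitrary
multiplicity `m`: `m*(H) = max_{w ∈ W} (2⌊m(wH)/2⌋ + 1)`. -/
def mstar (C : CoxSetup n hn hyp W) (m : hyp → ℤ) : hyp → ℤ :=
  fun H => Finset.univ.sup' ⟨1, Finset.mem_univ 1⟩
    (fun w : W => 2 * Int.fdiv (m (C.σ w H)) 2 + 1)

/-- A `CoxSetup` whose arrangement decomposes into exactly two `W`-orbits
`𝒜 = 𝒜₁ ∪ 𝒜₂` (`orb H = true` iff `H ∈ 𝒜₁`), with basic invariants
`P^{(i)}_1, …, P^{(i)}_n` of the reflection groups `W_i` of `𝒜_i` (generated by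
the reflections through the hyperplanes of `𝒜_i`), the partial derivatives
`∂/∂P^{(i)}_j`, so that `D₁ = ∂/∂P^{(1)}_n` is a primitive derivation for `𝒜₁`,
assumed to be `W`-invariant; together with the module `D(𝒜₁, −∞)` and the
inverse of the `T₁`-linear automorphism `∇_{D₁}` of `D(𝒜₁, −∞)^{W₁}`. -/
structure CoxSetup2 (n : ℕ) (hn : 0 < n) (hyp W : Type)
    [Fintype hyp] [Group W] [Fintype W] extends CoxSetup n hn hyp W : Type where
  /-- the orbit decomposition `𝒜 = 𝒜₁ ∪ 𝒜₂`: `orb H = true` iff `H ∈ 𝒜₁` -/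
  orb : hyp → Bool
  orb_equiv : ∀ (w : W) (H : hyp), orb (σ w H) = orb H
  orb_trans : ∀ H H' : hyp, orb H = orb H' → ∃ w : W, σ w H = H'
  orb_ne1 : ∃ H, orb H = true
  orb_ne2 : ∃ H, orb H = false
  /-- basic invariants of `W₁`, of degrees `d^{(1)}_1 ≤ … ≤ d^{(1)}_n = h₁` -/
  P1 : Fin n → SS n
  d1 : Fin n → ℕ
  d1_mono : Monotone d1
  d1_pos : ∀ i, 0 < d1 i
  P1_hom : ∀ i, (P1 i).IsHomogeneous (d1 i)
  P1_inv : ∀ (H : hyp), orb H = true → ∀ i, actS (reflW H) (P1 i) = P1 i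
  P1_indep : AlgebraicIndependent ℝ P1
  P1_gen : ∀ f : SS n, (∀ H : hyp, orb H = true → actS (reflW H) f = f) →
      f ∈ Algebra.adjoin ℝ (Set.range P1)
  /-- basic invariants of `W₂`, of degrees `d^{(2)}_1 ≤ … ≤ d^{(2)}_n = h₂` -/
  P2 : Fin n → SS n
  d2 : Fin n → ℕ
  d2_mono : Monotone d2
  d2_pos : ∀ i, 0 < d2 i
  P2_hom : ∀ i, (P2 i).IsHomogeneous (d2 i)
  P2_inv : ∀ (H : hyp), orb H = false → ∀ i, actS (reflW H) (P2 i) = P2 i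
  P2_indep : AlgebraicIndependent ℝ P2
  P2_gen : ∀ f : SS n, (∀ H : hyp, orb H = false → actS (reflW H) f = f) →
      f ∈ Algebra.adjoin ℝ (Set.range P2)
  /-- the partial derivatives `∂/∂P^{(1)}_j`; `D₁ = ∂/∂P^{(1)}_n` is a
  primitive derivation corresponding to the orbit `𝒜₁` -/
  dP1 : Fin n → DerF n
  dP1_eq : ∀ i j, dP1 i (toF (P1 j)) = if i = j then 1 else 0
  /-- the partial derivatives `∂/∂P^{(2)}_j` -/
  dP2 : Fin n → DerF n
  dP2_eq : ∀ i j, dP2 i (toF (P2 j)) = if i = j then 1 else 0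
  /-- the primitive derivation `D₁` is `W`-invariant -/
  D1_Winv : ∀ w : W, conjDer (actF w) (dP1 (lastIdx n hn)) = dP1 (lastIdx n hn)
  /-- the module `D(𝒜₁, −∞)` -/
  Dinf1 : Set (DerF n)
  Eul_mem1 : Eul ∈ Dinf1
  /-- the inverse of the `T₁`-linear automorphism
  `∇_{D₁} : D(𝒜₁, −∞)^{W₁} → D(𝒜₁, −∞)^{W₁}` ([AT09]) -/
  nablaD1inv : DerF n → DerF n
  nablaD1inv_spec : ∀ θ : DerF n, θ ∈ Dinf1 →
      (∀ H : hyp, orb H = true → conjDer (actF (reflW H)) θ = θ) →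
      nablaD1inv θ ∈ Dinf1 ∧
      (∀ H : hyp, orb H = true →
        conjDer (actF (reflW H)) (nablaD1inv θ) = nablaD1inv θ) ∧
      nabla (dP1 (lastIdx n hn)) (nablaD1inv θ) = θ ∧
      nablaD1inv (nabla (dP1 (lastIdx n hn)) θ) = θ

/-- The primitive derivation `D₁` corresponding to the orbit `𝒜₁`. -/
def D1prim (C : CoxSetup2 n hn hyp W) : DerF n := C.dP1 (lastIdx n hn)

/-- The derivation `E^{(p,q)} = ∇_D^{−q} ∇_{D₁}^{q−p} E`. -/
def EulPQ (C : CoxSetup2 n hn hyp W) (p q : ℤ) : DerF n :=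
  zpowIter (C.nabla (Dprim C.toCoxSetup)) C.nablaDinv (-q)
    (zpowIter (C.nabla (D1prim C)) C.nablaD1inv (q - p) C.Eul)

/-- The multiplicity `(m₁, m₂)` taking the constant value `m₁` on `𝒜₁` and
`m₂` on `𝒜₂`. -/
def multTwo (C : CoxSetup2 n hn hyp W) (m1 m2 : ℤ) : hyp → ℤ :=
  fun H => cond (C.orb H) m1 m2

/-- The Coxeter number `h₁` of `W₁`. -/
def cox1 (C : CoxSetup2 n hn hyp W) : ℤ := (C.d1 (lastIdx n hn) : ℤ)

/-- The Coxeter number `h₂` of `W₂`. -/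
def cox2 (C : CoxSetup2 n hn hyp W) : ℤ := (C.d2 (lastIdx n hn) : ℤ)

/-- `θ_i^{(p,q)} := ∇_{∂/∂P_i} E^{(p,q)}`. -/
def thetaPQ (C : CoxSetup2 n hn hyp W) (i : Fin n) (p q : ℤ) : DerF n :=
  C.nabla (C.dP i) (EulPQ C p q)

/-- `𝒢^{(p,q)} = ⊕_{i=1}^n T·θ_i^{(p,q)}`. -/
def GmodPQ (C : CoxSetup2 n hn hyp W) (p q : ℤ) : Set (DerF n) :=
  {θ | ∃ c : Fin n → SS n, (∀ i, c i ∈ Tker C.toCoxSetup) ∧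
    θ = ∑ i, toF (c i) • thetaPQ C i p q}


/-- `𝒢^{(k)}`: the `T`-span of `∇_{∂/∂P_1} ∇_D^{−k} ζ, …, ∇_{∂/∂P_n} ∇_D^{−k} ζ`. -/
def GmodK (C : CoxSetup n hn hyp W) (ζ : DerF n) (k : ℕ) : Set (DerF n) :=
  {θ | ∃ c : Fin n → SS n, (∀ i, c i ∈ Tker C) ∧
    θ = ∑ i, toF (c i) • C.nabla (C.dP i) (C.nablaDinv^[k] ζ)}

/-- The sum `Σ_{k ≥ 0} 𝒢^{(k)} ⊆ Der_F`. -/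
def sumGmod (C : CoxSetup n hn hyp W) (ζ : DerF n) : Set (DerF n) :=
  {θ | ∃ (N : ℕ) (g : ℕ → DerF n), (∀ k, g k ∈ GmodK C ζ k) ∧
    θ = ∑ k ∈ Finset.range N, g k}

lemma ip1_self_ne_zero {α : SS n} (hα : α.IsHomogeneous 1) (h0 : α ≠ 0) : ip1 α α ≠ 0 := by
  intro h
  apply h0
  have hc : ∀ i, α.coeff (Finsupp.single i 1) = 0 := by
    intro i
    have := (Finset.sum_eq_zero_iff_of_nonneg fun i _ => mul_self_nonneg _).1 h i
      (Finset.mem_univ i)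
    exact mul_self_eq_zero.1 this
  ext d
  rw [coeff_zero]
  by_contra hd
  have hdeg : d.degree = 1 := by
    rw [Finsupp.degree_eq_weight_one]
    exact hα hd
  obtain ⟨i, rfl⟩ : ∃ i, d = Finsupp.single i 1 :=
    (Finsupp.sum_eq_one_iff d).1 hdeg
  exact hd (hc i)

lemma prime_of_isHomogeneous_one {α : SS n} (hα : α.IsHomogeneous 1) (h0 : α ≠ 0) :
    Prime α := by
  refine (irreducible_of_totalDegree_eq_one (hα.totalDegree h0) fun x hx => ?_).prime
  refine isUnit_iff_ne_zero.2 fun hx0 => h0 ?_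
  ext d
  simpa [hx0] using hx d

/-- A reflection acts trivially modulo the linear form defining its hyperplane. -/
lemma dvd_actS_reflW_sub (C : CoxSetup n hn hyp W) (H : hyp) (f : SS n) :
    C.α H ∣ C.actS (C.reflW H) f - f := by
  set α := C.α H with hα
  have hq := ip1_self_ne_zero (C.α_hom H) (C.α_ne H)
  rw [← hα] at hq
  let q := Ideal.Quotient.mkₐ ℝ (Ideal.span {α})
  have key : q.comp (C.actS (C.reflW H)).toAlgHom = q := by
    refine MvPolynomial.algHom_ext fun i => ?_
    set c : ℝ := ip1 (X i) α / ip1 α α with hc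
    have hp : (X i - c • α : SS n).IsHomogeneous 1 := by
      rw [smul_eq_C_mul]
      exact (isHomogeneous_X ℝ i).sub (by simpa using (isHomogeneous_C _ c).mul (C.α_hom H))
    have horth : ip1 (X i - c • α) α = 0 := by
      have : ip1 (X i - c • α) α = ip1 (X i) α - c * ip1 α α := by
        simp only [ip1, coeff_sub, coeff_smul, smul_eq_mul, sub_mul, Finset.sum_sub_distrib,
          Finset.mul_sum, mul_assoc]
      rw [this, hc, div_mul_cancel₀ _ hq, sub_self]
    have hfix := C.reflW_fix H _ hp horth
    rw [map_sub, map_smul, C.reflW_α] at hfix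
    have hX : C.actS (C.reflW H) (X i) - X i = MvPolynomial.C (-2 * c) * α := by
      rw [← hα, smul_eq_C_mul, smul_eq_C_mul] at hfix
      rw [map_mul, map_neg, map_ofNat]
      linear_combination hfix
    change Ideal.Quotient.mk _ (C.actS (C.reflW H) (X i)) = Ideal.Quotient.mk _ (X i)
    rw [Ideal.Quotient.mk_eq_mk_iff_sub_mem, Ideal.mem_span_singleton, hX]
    exact dvd_mul_left _ _
  have := DFunLike.congr_fun key f
  change Ideal.Quotient.mk _ (C.actS (C.reflW H) f) = Ideal.Quotient.mk _ f at this
  rwa [Ideal.Quotient.mk_eq_mk_iff_sub_mem, Ideal.mem_span_singleton] at this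

lemma toF_injective : Function.Injective (toF (n := n)) :=
  IsFractionRing.injective (SS n) (FF n)

/-- An invariant derivation maps `α_H` to an anti-invariant of the reflection through `H`. -/
lemma actF_reflW_apply_α (C : CoxSetup n hn hyp W) (H : hyp) {θ : DerF n}
    (hinv : invDer C θ) :
    C.actF (C.reflW H) (θ (toF (C.α H))) = -θ (toF (C.α H)) := by
  have hneg : C.actF (C.reflW H) (toF (C.α H)) = -toF (C.α H) := by
    rw [C.actF_compat, C.reflW_α]
    exact map_neg _ _
  have h := DFunLike.congr_fun (hinv (C.reflW H)) (C.actF (C.reflW H) (toF (C.α H)))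
  change C.actF (C.reflW H) (θ ((C.actF (C.reflW H)).symm
    (C.actF (C.reflW H) (toF (C.α H))))) = _ at h
  rw [AlgEquiv.symm_apply_apply, hneg, map_neg] at h
  exact h

theorem stmt19 (C : CoxSetup n hn hyp W) (H : hyp) (θ : DerF n)
    (hθ : θ ∈ C.Dinf) (hinv : invDer C θ) (m : ℤ)
    (hpar : MemLoc (C.α H) (2 * m) (θ (toF (C.α H)))) :
    MemLoc (C.α H) (2 * m + 1) (θ (toF (C.α H))) := by
  obtain ⟨s, t, ht, hst⟩ := hpar
  have hα0 : toF (C.α H) ≠ 0 := fun h => C.α_ne H (toF_injective (h.trans (map_zero _).symm))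
  have hst' := congrArg (C.actF (C.reflW H)) hst
  rw [map_mul, map_mul, map_zpow₀, C.actF_compat, C.actF_compat, C.actF_compat, C.reflW_α,
    actF_reflW_apply_α C H hinv, show toF (-C.α H) = -toF (C.α H) from map_neg _ _,
    (even_two_mul m).neg_zpow] at hst'
  have hsum : s * C.actS (C.reflW H) t + C.actS (C.reflW H) s * t = 0 := by
    apply toF_injective
    have hF : toF s * toF (C.actS (C.reflW H) t) + toF (C.actS (C.reflW H) s) * toF t = 0 := by
      apply mul_left_cancel₀ (zpow_ne_zero (2 * m) hα0)
      linear_combination -(toF (C.actS (C.reflW H) t)) * hst - toF t * hst'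
    simpa [toF] using hF
  obtain ⟨a, ha⟩ := dvd_actS_reflW_sub C H t
  obtain ⟨b, hb⟩ := dvd_actS_reflW_sub C H s
  have hprime := prime_of_isHomogeneous_one (C.α_hom H) (C.α_ne H)
  have hdvd : C.α H ∣ s * t := by
    have h2 : (MvPolynomial.C (1 / 2 : ℝ) : SS n) * 2 = 1 := by
      rw [show (2 : SS n) = MvPolynomial.C 2 from (map_ofNat MvPolynomial.C 2).symm,
        ← MvPolynomial.C_mul]
      norm_num
    refine ⟨-MvPolynomial.C (1 / 2) * (s * a + b * t), ?_⟩
    linear_combination MvPolynomial.C (1 / 2) * (hsum - s * ha - t * hb) - s * t * h2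
  rw [Ideal.mem_span_singleton] at ht
  obtain ⟨r, rfl⟩ := (hprime.dvd_or_dvd hdvd).resolve_right ht
  refine ⟨r, t, by rwa [Ideal.mem_span_singleton], ?_⟩
  rw [hst, zpow_add₀ hα0, zpow_one, mul_assoc]
  congr 1
  exact map_mul _ _ _

end
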